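/- Let c > 1 and b = c(c+1). In the partizan subtraction game with S_L = {c, c+1} and S_R = {1, b}, there are infinitely many heap sizes with outcome L and infinitely many heap sizes with outcome R; in particular, for every n, if the outcome of n is L then the outcome of n + b + c is L, and if the outcome of n is R then the outcome of n + b + c is R, while o(1) = R and o(c+1) = L. -/

import Mathlib

mutual
def LeftFirstWins (SL SR : Finset ℕ) : ℕ → Prop
  | n => ∃ s ∈ SL, ∃ (_ : 0 < s) (_ : s ≤ n), ¬ RightFirstWins SL SR (n - s)
  termination_by n => n
  decreasing_by omega
def RightFirstWins (SL SR : Finset ℕ) : ℕ → Prop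
  | n => ∃ s ∈ SR, ∃ (_ : 0 < s) (_ : s ≤ n), ¬ LeftFirstWins SL SR (n - s)
  termination_by n => n
  decreasing_by omega
end

inductive Outcome | P | L | R | N
deriving DecidableEq

open Classical in
noncomputable def outcome (SL SR : Finset ℕ) (n : ℕ) : Outcome :=
  if LeftFirstWins SL SR n then
    if RightFirstWins SL SR n then .N else .L
  else
    if RightFirstWins SL SR n then .R else .P

theorem leftFirstWins_pair_iff {a b : ℕ} (ha : 0 < a) (hb : 0 < b) (SR : Finset ℕ) (n : ℕ) :
    LeftFirstWins {a, b} SR n ↔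
      (a ≤ n ∧ ¬ RightFirstWins {a, b} SR (n - a)) ∨
        (b ≤ n ∧ ¬ RightFirstWins {a, b} SR (n - b)) := by
  rw [LeftFirstWins]
  simp [ha, hb]

theorem rightFirstWins_pair_iff {a b : ℕ} (ha : 0 < a) (hb : 0 < b) (SL : Finset ℕ) (n : ℕ) :
    RightFirstWins SL {a, b} n ↔
      (a ≤ n ∧ ¬ LeftFirstWins SL {a, b} (n - a)) ∨
        (b ≤ n ∧ ¬ LeftFirstWins SL {a, b} (n - b)) := by
  rw [RightFirstWins]
  simp [ha, hb]

/-- The heap sizes, with `c = e + 1`, are arranged in periods of `c` rows of length `c + 2`;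
this is the heap size in period `q`, row `k` and column `j`. -/
def gridHeap (e q k j : ℕ) : ℕ := (q * (e + 1) + k) * (e + 3) + j

theorem exists_eq_gridHeap (e n : ℕ) :
    ∃ q k j, k ≤ e ∧ j ≤ e + 2 ∧ n = gridHeap e q k j := by
  refine ⟨n / (e + 3) / (e + 1), n / (e + 3) % (e + 1), n % (e + 3), ?_, ?_, ?_⟩
  · have := Nat.mod_lt (n / (e + 3)) (show 0 < e + 1 by omega)
    omega
  · have := Nat.mod_lt n (show 0 < e + 3 by omega)
    omega
  · rw [gridHeap, Nat.div_add_mod', Nat.div_add_mod']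

theorem firstWins_gridHeap_iff {e : ℕ} (he : 0 < e) (q k j : ℕ) (hk : k ≤ e) (hj : j ≤ e + 2) :
    (LeftFirstWins {e + 1, e + 2} {1, (e + 1) * (e + 2)} (gridHeap e q k j) ↔
      1 ≤ j ∧ e + 1 ≤ j + k) ∧
    (RightFirstWins {e + 1, e + 2} {1, (e + 1) * (e + 2)} (gridHeap e q k j) ↔
      1 ≤ j ∧ (j + k ≤ e + 1 ∨ k = e)) := by
  generalize hn : gridHeap e q k j = n
  induction n using Nat.strong_induction_on generalizing q k j with
  | _ n ih =>
  have right_move (d q' k' j' : ℕ) (hd : 0 < d) (h : gridHeap e q' k' j' + d = n) (hk' : k' ≤ e)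
      (hj' : j' ≤ e + 2) :
      (d ≤ n ∧ ¬ LeftFirstWins {e + 1, e + 2} {1, (e + 1) * (e + 2)} (n - d)) ↔
        ¬ (1 ≤ j' ∧ e + 1 ≤ j' + k') := by
    rw [(ih (n - d) (by omega) q' k' j' hk' hj' (by omega)).1]
    exact and_iff_right (by omega)
  have left_move (d q' k' j' : ℕ) (hd : 0 < d) (h : gridHeap e q' k' j' + d = n) (hk' : k' ≤ e)
      (hj' : j' ≤ e + 2) :
      (d ≤ n ∧ ¬ RightFirstWins {e + 1, e + 2} {1, (e + 1) * (e + 2)} (n - d)) ↔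
        ¬ (1 ≤ j' ∧ (j' + k' ≤ e + 1 ∨ k' = e)) := by
    rw [(ih (n - d) (by omega) q' k' j' hk' hj' (by omega)).2]
    exact and_iff_right (by omega)
  have hb : 0 < (e + 1) * (e + 2) := by positivity
  constructor
  · rw [leftFirstWins_pair_iff (by omega) (by omega)]
    obtain hj1 | rfl | rfl : j < e + 1 ∨ j = e + 1 ∨ j = e + 2 := by omega
    · obtain _ | k := k
      · obtain _ | q := q
        · simp only [gridHeap] at hn
          omega
        · rw [left_move (e + 1) q e (j + 2) (by omega) (by rw [← hn]; simp only [gridHeap]; ring)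
              (by omega) (by omega),
            left_move (e + 2) q e (j + 1) (by omega) (by rw [← hn]; simp only [gridHeap]; ring)
              (by omega) (by omega)]
          omega
      · rw [left_move (e + 1) q k (j + 2) (by omega) (by rw [← hn]; simp only [gridHeap]; ring)
            (by omega) (by omega),
          left_move (e + 2) q k (j + 1) (by omega) (by rw [← hn]; simp only [gridHeap]; ring)
            (by omega) (by omega)]
        omega
    · rw [left_move (e + 1) q k 0 (by omega) (by rw [← hn]; simp only [gridHeap]; ring)
        (by omega) (by omega)]
      omega
    · rw [left_move (e + 2) q k 0 (by omega) (by rw [← hn]; simp only [gridHeap]; ring)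
        (by omega) (by omega)]
      omega
  · have one_move : (1 ≤ n ∧ ¬ LeftFirstWins {e + 1, e + 2} {1, (e + 1) * (e + 2)} (n - 1)) ↔
        1 ≤ j ∧ (j = 1 ∨ j + k ≤ e + 1) := by
      obtain _ | j := j
      · obtain _ | k := k
        · obtain _ | q := q
          · simp only [gridHeap] at hn
            omega
          · rw [right_move 1 q e (e + 2) (by omega) (by rw [← hn]; simp only [gridHeap]; ring)
              (by omega) (by omega)]
            omega
        · rw [right_move 1 q k (e + 2) (by omega) (by rw [← hn]; simp only [gridHeap]; ring)
            (by omega) (by omega)]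
          omega
      · rw [right_move 1 q k j (by omega) (by rw [← hn]; simp only [gridHeap]; ring)
          (by omega) (by omega)]
        omega
    rw [rightFirstWins_pair_iff one_pos hb, one_move]
    obtain hj1 | ⟨j, rfl⟩ : j < 2 ∨ ∃ i, j = i + 2 := by
      rcases lt_or_ge j 2 with h | h
      · exact .inl h
      · exact .inr ⟨j - 2, by omega⟩
    · obtain _ | q := q
      · have : n < (e + 1) * (e + 2) := by
          rw [← hn, gridHeap]
          nlinarith
        omega
      · rw [right_move _ q k (j + (e + 1)) hb (by rw [← hn]; simp only [gridHeap]; ring)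
          (by omega) (by omega)]
        omega
    · obtain rfl | hk := hk.eq_or_lt
      · rw [right_move _ q 0 j hb (by rw [← hn]; simp only [gridHeap]; ring)
          (by omega) (by omega)]
        omega
      · obtain _ | q := q
        · have : n < (e + 1) * (e + 2) := by
            rw [← hn, gridHeap]
            nlinarith
          omega
        · rw [right_move _ q (k + 1) j hb (by rw [← hn]; simp only [gridHeap]; ring)
            (by omega) (by omega)]
          omega

theorem outcome_eq_L_iff (SL SR : Finset ℕ) (n : ℕ) :
    outcome SL SR n = .L ↔ LeftFirstWins SL SR n ∧ ¬ RightFirstWins SL SR n := by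
  unfold outcome
  split_ifs <;> simp_all

theorem outcome_eq_R_iff (SL SR : Finset ℕ) (n : ℕ) :
    outcome SL SR n = .R ↔ ¬ LeftFirstWins SL SR n ∧ RightFirstWins SL SR n := by
  unfold outcome
  split_ifs <;> simp_all

theorem outcome_gridHeap_eq_L_iff {e : ℕ} (he : 0 < e) (q k j : ℕ) (hk : k ≤ e)
    (hj : j ≤ e + 2) :
    outcome {e + 1, e + 2} {1, (e + 1) * (e + 2)} (gridHeap e q k j) = .L ↔
      e + 1 < j + k ∧ k < e := by
  rw [outcome_eq_L_iff, (firstWins_gridHeap_iff he q k j hk hj).1,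
    (firstWins_gridHeap_iff he q k j hk hj).2]
  omega

theorem outcome_gridHeap_eq_R_iff {e : ℕ} (he : 0 < e) (q k j : ℕ) (hk : k ≤ e)
    (hj : j ≤ e + 2) :
    outcome {e + 1, e + 2} {1, (e + 1) * (e + 2)} (gridHeap e q k j) = .R ↔
      1 ≤ j ∧ j + k < e + 1 := by
  rw [outcome_eq_R_iff, (firstWins_gridHeap_iff he q k j hk hj).1,
    (firstWins_gridHeap_iff he q k j hk hj).2]
  omega

theorem gridHeap_add_period (e q k j : ℕ) :
    gridHeap e q k j + (e + 1) * (e + 2) + (e + 1) = gridHeap e (q + 1) k j := by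
  simp only [gridHeap]
  ring

theorem le_gridHeap (e q k j : ℕ) : q ≤ gridHeap e q k j := by
  rw [gridHeap]
  nlinarith [Nat.zero_le (q * e * e), Nat.zero_le (q * e), Nat.zero_le (k * e)]

theorem stmt_13 (c : ℕ) (hc : 1 < c) (b : ℕ) (hb : b = c * (c + 1)) :
    (∀ n : ℕ, outcome {c, c + 1} {1, b} n = .L →
      outcome {c, c + 1} {1, b} (n + b + c) = .L) ∧
    (∀ n : ℕ, outcome {c, c + 1} {1, b} n = .R →
      outcome {c, c + 1} {1, b} (n + b + c) = .R) ∧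
    outcome {c, c + 1} {1, b} 1 = .R ∧
    outcome {c, c + 1} {1, b} (c + 1) = .L ∧
    (∀ N : ℕ, ∃ n ≥ N, outcome {c, c + 1} {1, b} n = .L) ∧
    (∀ N : ℕ, ∃ n ≥ N, outcome {c, c + 1} {1, b} n = .R) := by
  subst hb
  obtain ⟨e, rfl⟩ : ∃ e, c = e + 1 := ⟨c - 1, by omega⟩
  have he : 0 < e := by omega
  have h_one : 1 = gridHeap e 0 0 1 := by simp [gridHeap]
  have h_col : e + 2 = gridHeap e 0 0 (e + 2) := by simp [gridHeap]
  refine ⟨fun n h ↦ ?_, fun n h ↦ ?_, ?_, ?_, fun N ↦ ?_, fun N ↦ ?_⟩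
  · obtain ⟨q, k, j, hk, hj, rfl⟩ := exists_eq_gridHeap e n
    rw [gridHeap_add_period]
    exact (outcome_gridHeap_eq_L_iff he _ k j hk hj).2
      ((outcome_gridHeap_eq_L_iff he q k j hk hj).1 h)
  · obtain ⟨q, k, j, hk, hj, rfl⟩ := exists_eq_gridHeap e n
    rw [gridHeap_add_period]
    exact (outcome_gridHeap_eq_R_iff he _ k j hk hj).2
      ((outcome_gridHeap_eq_R_iff he q k j hk hj).1 h)
  · have := (outcome_gridHeap_eq_R_iff he 0 0 1 (by omega) (by omega)).2 (by omega)
    rwa [← h_one] at this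
  · have := (outcome_gridHeap_eq_L_iff he 0 0 (e + 2) (by omega) (by omega)).2 (by omega)
    rwa [← h_col] at this
  · exact ⟨_, le_gridHeap e N 0 (e + 2),
      (outcome_gridHeap_eq_L_iff he N 0 _ (by omega) (by omega)).2 (by omega)⟩
  · exact ⟨_, le_gridHeap e N 0 1,
      (outcome_gridHeap_eq_R_iff he N 0 _ (by omega) (by omega)).2 (by omega)⟩
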